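/- In the setting below, for all distinct s, t ∈ S such that the product st has finite order m in W, the alternating composite T_s ∘ T_t ∘ T_s ∘ ⋯ with m factors equals the alternating composite T_t ∘ T_s ∘ T_t ∘ ⋯ with m factors, as R-linear endomorphisms of M. -/

import Mathlib

open Finsupp

noncomputable section

/-- `R = ℤ[u, u⁻¹]`, the ring of Laurent polynomials over `ℤ`. -/
abbrev R : Type := LaurentPolynomial ℤ

/-- The indeterminate `u`. -/
noncomputable def u : R := LaurentPolynomial.T 1

/-- `I_* = {w ∈ W : w* = w⁻¹}`, the set of twisted involutions. -/
def Istar {W : Type*} [Group W] (star : W ≃* W) : Set W := {w : W | star w = w⁻¹}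

/-- `M`, the free `R`-module with basis `(a_w)` indexed by `w ∈ I_*`
(the basis element `a_w` is `Finsupp.single w 1`). -/
abbrev InvolModule {W : Type*} [Group W] (star : W ≃* W) : Type _ := ↥(Istar star) →₀ R

/-- The assertion that the `R`-linear map `T : M → M` is the map `T_s` (for `s` the
simple reflection of index `i`) defined by:
`T_s a_w = u a_w + (u+1) a_{sw}` if `sw = w s*` and `l(sw) > l(w)`;
`T_s a_w = (u²−u−1) a_w + (u²−u) a_{sw}` if `sw = w s*` and `l(sw) < l(w)`;
`T_s a_w = a_{s w s*}` if `sw ≠ w s*` and `l(sw) > l(w)`;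
`T_s a_w = (u²−1) a_w + u² a_{s w s*}` if `sw ≠ w s*` and `l(sw) < l(w)`. -/
def IsTs {B W : Type*} [Group W] {Mat : CoxeterMatrix B} (cs : CoxeterSystem Mat W)
    (star : W ≃* W) (i : B) (T : InvolModule star →ₗ[R] InvolModule star) : Prop :=
  ∀ w : ↥(Istar star),
    (∀ w' : ↥(Istar star), (w' : W) = cs.simple i * (w : W) →
      cs.simple i * (w : W) = (w : W) * star (cs.simple i) →
      (cs.length (cs.simple i * (w : W)) > cs.length (w : W) →
        T (single w 1) = u • single w 1 + (u + 1) • single w' 1) ∧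
      (cs.length (cs.simple i * (w : W)) < cs.length (w : W) →
        T (single w 1) = (u ^ 2 - u - 1) • single w 1 + (u ^ 2 - u) • single w' 1)) ∧
    (∀ w' : ↥(Istar star), (w' : W) = cs.simple i * (w : W) * star (cs.simple i) →
      cs.simple i * (w : W) ≠ (w : W) * star (cs.simple i) →
      (cs.length (cs.simple i * (w : W)) > cs.length (w : W) →
        T (single w 1) = single w' 1) ∧
      (cs.length (cs.simple i * (w : W)) < cs.length (w : W) →
        T (single w 1) = (u ^ 2 - 1) • single w 1 + (u ^ 2 : R) • single w' 1))

/-- The alternating composite `f ∘ g ∘ f ∘ ⋯` with `m` factors (the leftmost factor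
being `f`), as an endomorphism. -/
def altComp {S N : Type*} [CommSemiring S] [AddCommMonoid N] [Module S N]
    (f g : Module.End S N) : ℕ → Module.End S N
  | 0 => 1
  | n + 1 => f * altComp g f n

/-- The alternating product `a * b * a * ⋯` with `n` factors, the leftmost one being `a`. -/
def altProd {G : Type*} [Monoid G] (a b : G) : ℕ → G
  | 0 => 1
  | n + 1 => a * altProd b a n

@[simp]
theorem altProd_zero {G : Type*} [Monoid G] (a b : G) : altProd a b 0 = 1 := rfl

theorem altProd_succ {G : Type*} [Monoid G] (a b : G) (n : ℕ) :
    altProd a b (n + 1) = a * altProd b a n := rfl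

theorem altProd_succ_right {G : Type*} [Monoid G] (a b : G) (n : ℕ) :
    altProd a b (n + 1) = altProd a b n * (if Even n then a else b) := by
  induction n generalizing a b with
  | zero => simp [altProd]
  | succ n ih =>
    rw [altProd_succ, ih, altProd_succ a b n, mul_assoc]
    by_cases h : Even n <;> simp [h, Nat.even_add_one, -Nat.not_even_iff_odd]

theorem altProd_two_mul {G : Type*} [Monoid G] (a b : G) (n : ℕ) :
    altProd a b (2 * n) = (a * b) ^ n := by
  induction n with
  | zero => simp
  | succ n ih => rw [mul_add_one, altProd_succ, altProd_succ, ih, pow_succ', mul_assoc]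

theorem altProd_mul_inv_swap {G : Type*} [Group G] {a b : G} (ha : a * a = 1) (hb : b * b = 1)
    (n : ℕ) : altProd a b n * (altProd b a n)⁻¹ = altProd a b (2 * n) := by
  induction n generalizing a b with
  | zero => simp
  | succ n ih =>
    have h : altProd b a (2 * n) * b = altProd b a (2 * n + 1) := by
      simp [altProd_succ_right]
    rw [altProd_succ, altProd_succ b a, mul_inv_rev, inv_eq_of_mul_eq_one_right hb, mul_add_one,
      altProd_succ, ← h, ← ih hb ha]
    simp only [mul_assoc]

theorem altProd_succ_mul_inv {G : Type*} [Group G] {a b : G} (ha : a * a = 1) (hb : b * b = 1)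
    (n : ℕ) : altProd a b (n + 1) * (altProd a b n)⁻¹ = altProd a b (2 * n + 1) := by
  rw [altProd_succ, altProd_succ, ← altProd_mul_inv_swap hb ha, mul_assoc]

theorem altProd_eq_swap_iff {G : Type*} [Group G] {a b : G} (ha : a * a = 1) (hb : b * b = 1)
    (n : ℕ) : altProd a b n = altProd b a n ↔ (a * b) ^ n = 1 := by
  rw [← mul_inv_eq_one, altProd_mul_inv_swap ha hb, altProd_two_mul]

theorem map_altProd {G H F : Type*} [Monoid G] [Monoid H] [FunLike F G H] [MonoidHomClass F G H]
    (f : F) (a b : G) (n : ℕ) : f (altProd a b n) = altProd (f a) (f b) n := by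
  induction n generalizing a b with
  | zero => simp
  | succ n ih => simp [altProd_succ, ih]

theorem altComp_eq_altProd {S N : Type*} [CommSemiring S] [AddCommMonoid N] [Module S N]
    (f g : Module.End S N) (n : ℕ) : altComp f g n = altProd f g n := by
  induction n generalizing f g with
  | zero => rfl
  | succ n ih => rw [altComp, ih, altProd_succ]

theorem altProd_mem_closure {G : Type*} [Group G] (a b : G) (n : ℕ) :
    altProd a b n ∈ Subgroup.closure {a, b} := by
  induction n generalizing a b with
  | zero => exact one_mem _
  | succ n ih =>
    refine mul_mem (Subgroup.subset_closure (by simp)) ?_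
    rw [Set.pair_comm]
    exact ih b a

theorem exists_altProd_of_mem_closure_pair {G : Type*} [Group G] {a b : G} (ha : a * a = 1)
    (hb : b * b = 1) {m : ℕ} (hm : 0 < m) (hab : (a * b) ^ m = 1) {x : G}
    (hx : x ∈ Subgroup.closure {a, b}) :
    ∃ k ≤ m, x = altProd a b k ∨ x = altProd b a k := by
  have hbraid : altProd a b m = altProd b a m := (altProd_eq_swap_iff ha hb m).2 hab
  have key : ∀ c d : G, c * c = 1 → altProd c d m = altProd d c m → ∀ k ≤ m,
      (∃ l ≤ m, c * altProd c d k = altProd c d l ∨ c * altProd c d k = altProd d c l) ∧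
      (∃ l ≤ m, c * altProd d c k = altProd c d l ∨ c * altProd d c k = altProd d c l) := by
    intro c d hc hcd k hk
    have h1 : ∀ k ≤ m,
      (∃ l ≤ m, c * altProd c d k = altProd c d l ∨ c * altProd c d k = altProd d c l) := by
      intro k hk
      cases k with
      | zero => exact ⟨1, hm, Or.inl (by simp [altProd])⟩
      | succ k =>
        exact ⟨k, by omega, Or.inr (by rw [altProd_succ, ← mul_assoc, hc, one_mul])⟩
    refine ⟨h1 k hk, ?_⟩
    rcases hk.eq_or_lt with rfl | hk
    · rw [← hcd]
      exact h1 k le_rfl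
    · exact ⟨k + 1, hk, Or.inl rfl⟩
  induction hx using Subgroup.closure_induction_left with
  | one => exact ⟨0, by simp⟩
  | mul_left y hy x _ ih =>
    obtain ⟨k, hk, h⟩ := ih
    have h1 := key a b ha hbraid k hk
    have h2 := key b a hb hbraid.symm k hk
    rcases hy with rfl | rfl <;> rcases h with rfl | rfl
    · exact h1.1
    · exact h1.2
    · obtain ⟨l, hl, h⟩ := h2.2
      exact ⟨l, hl, h.symm⟩
    · obtain ⟨l, hl, h⟩ := h2.1
      exact ⟨l, hl, h.symm⟩
  | inv_mul_cancel y hy x _ ih =>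
    obtain ⟨k, hk, h⟩ := ih
    have h1 := key a b ha hbraid k hk
    have h2 := key b a hb hbraid.symm k hk
    rcases hy with rfl | rfl <;> rcases h with rfl | rfl
    · rw [inv_eq_of_mul_eq_one_right ha]; exact h1.1
    · rw [inv_eq_of_mul_eq_one_right ha]; exact h1.2
    · rw [inv_eq_of_mul_eq_one_right hb]
      obtain ⟨l, hl, h⟩ := h2.2
      exact ⟨l, hl, h.symm⟩
    · rw [inv_eq_of_mul_eq_one_right hb]
      obtain ⟨l, hl, h⟩ := h2.1
      exact ⟨l, hl, h.symm⟩

theorem SemiconjBy.altProd {G : Type*} [Monoid G] {d a b a' b' : G} (ha : SemiconjBy d a a')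
    (hb : SemiconjBy d b b') (n : ℕ) : SemiconjBy d (altProd a b n) (altProd a' b' n) := by
  induction n generalizing a b a' b' with
  | zero => exact SemiconjBy.one_right d
  | succ n ih => exact ha.mul_right (ih hb ha)

section QuadraticRelation

variable {K E : Type*} [CommRing K] [Ring E] [Algebra K E] {q : K} {a b : E}

theorem mul_altProd_succ_of_quadratic (ha : a * a = (q - 1) • a + q • 1) (k : ℕ) :
    a * altProd a b (k + 1) = (q - 1) • altProd a b (k + 1) + q • altProd b a k := by
  rw [altProd_succ, ← mul_assoc, ha, add_mul, smul_mul_assoc, smul_mul_assoc, one_mul]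

theorem add_mul_altProd_sub (ha : a * a = (q - 1) • a + q • 1) (hb : b * b = (q - 1) • b + q • 1)
    (k : ℕ) :
    altProd a b (k + 2) - altProd b a (k + 2) =
      ((q - 1) • 1 - (a + b)) * (altProd a b (k + 1) - altProd b a (k + 1)) -
        q • (altProd a b k - altProd b a k) := by
  rw [altProd_succ a b (k + 1), altProd_succ b a (k + 1), sub_mul, add_mul, mul_sub a, mul_sub b,
    mul_altProd_succ_of_quadratic ha, mul_altProd_succ_of_quadratic hb, smul_mul_assoc, one_mul,
    smul_sub, smul_sub]
  abel

theorem altProd_sub_mul (ha : a * a = (q - 1) • a + q • 1) (hb : b * b = (q - 1) • b + q • 1)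
    (k : ℕ) :
    (altProd a b (k + 1) - altProd b a (k + 1)) * (if Even k then b else a) =
      ((q - 1) • 1 - a) * (altProd a b (k + 1) - altProd b a (k + 1)) := by
  have h1 : altProd a b (k + 1) * (if Even k then b else a) = a * altProd b a (k + 1) := by
    rw [← altProd_succ, altProd_succ_right a b (k + 1)]
    by_cases h : Even k <;> simp [h, Nat.even_add_one, -Nat.not_even_iff_odd]
  have h2 : altProd b a (k + 1) * (if Even k then b else a) =
      (q - 1) • altProd b a (k + 1) + q • altProd b a k := by
    rw [altProd_succ_right, mul_assoc]
    split_ifs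
    · rw [hb, mul_add, mul_smul_comm, mul_smul_comm, mul_one]
    · rw [ha, mul_add, mul_smul_comm, mul_smul_comm, mul_one]
  rw [sub_mul, h1, h2, sub_mul, mul_sub a, mul_altProd_succ_of_quadratic ha, smul_mul_assoc,
    one_mul, smul_sub]
  abel

theorem altProd_sub_apply_eq_zero {N : Type*} [AddCommGroup N] [Module K N]
    {a b : Module.End K N} (ha : a * a = (q - 1) • a + q • 1) (hb : b * b = (q - 1) • b + q • 1)
    {k : ℕ} {x : N} (hx : altProd a b (k + 1) x = altProd b a (k + 1) x) :
    altProd a b (k + 1) (a x) = altProd b a (k + 1) (a x) := by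
  have hx' : (altProd a b (k + 1) - altProd b a (k + 1)) x = 0 := by
    rw [LinearMap.sub_apply, hx, sub_self]
  have h1 := LinearMap.congr_fun (altProd_sub_mul ha hb k) x
  have h2 := LinearMap.congr_fun (altProd_sub_mul hb ha k) x
  rw [← neg_sub (altProd a b (k + 1)), neg_mul, mul_neg] at h2
  rw [Module.End.mul_apply, Module.End.mul_apply, hx', map_zero] at h1
  rw [LinearMap.neg_apply, LinearMap.neg_apply, Module.End.mul_apply, Module.End.mul_apply, hx',
    map_zero, neg_zero, neg_eq_zero] at h2
  rw [← sub_eq_zero, ← LinearMap.sub_apply]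
  by_cases h : Even k
  · simpa only [h, if_true] using h2
  · simpa only [h, if_false] using h1

end QuadraticRelation

section Recurrence

variable {K E : Type*} [CommRing K] [AddCommGroup E] [Module K E] {q : K} {N : E →ₗ[K] E}
  {f : ℕ → E}

theorem eq_zero_of_recurrence (hf : ∀ k, f (k + 2) = N (f (k + 1)) - q • f k) (h0 : f 0 = 0)
    {a b : ℕ} {c : K} (h1 : f a = c • f (b + 1)) (h2 : f (a + 1) = (c * q) • f b) :
    f (a + b + 1) = 0 := by
  induction b generalizing a c with
  | zero => simpa [h0] using h2
  | succ b ih =>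
    have h : f (a + 1 + 1) = (c * q * q) • f b := by
      have h3 := hf b
      rw [hf a, h2, h1, h3, map_smul]
      module
    have h4 := ih h2 h
    rwa [add_right_comm a 1 b] at h4

theorem eq_zero_of_recurrence_of_sq_eq (hf : ∀ k, f (k + 2) = N (f (k + 1)) - q • f k)
    (h0 : f 0 = 0) {p : ℕ} (hp : p ≠ 0) {c : K} (hc : c ^ 2 = q) (h : f (p + 1) = c • f p) :
    f (2 * p + 1) = 0 := by
  obtain ⟨b, rfl⟩ := Nat.exists_eq_succ_of_ne_zero hp
  have h1 : f (b + 2 + 1) = (c * q) • f b := by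
    have h2 := hf b
    have h3 : q • f b = N (f (b + 1)) - f (b + 2) := by rw [h2]; abel
    rw [mul_smul, h3, hf (b + 1), h, map_smul, smul_sub, smul_smul, ← sq, hc]
  have h4 := eq_zero_of_recurrence hf h0 h h1
  rwa [show b.succ + 1 + b + 1 = 2 * b.succ + 1 by omega] at h4

end Recurrence

namespace CoxeterSystem

variable {B W : Type*} [Group W] {Mat : CoxeterMatrix B} (cs : CoxeterSystem Mat W)

open Classical in
/-- The action of a simple reflection on `W × ZMod 2`: it conjugates the first coordinate and
flips the second one exactly when the first one is that simple reflection. -/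
def signedConj (i : B) : Function.End (W × ZMod 2) := fun p =>
  (cs.simple i * p.1 * cs.simple i, p.2 + if p.1 = cs.simple i then 1 else 0)

open Classical in
theorem signedConj_mul_pow_apply (i j : B) (n : ℕ) (t : W) (e : ZMod 2) :
    ((cs.signedConj i * cs.signedConj j) ^ n) (t, e) =
      ((cs.simple i * cs.simple j) ^ n * t * ((cs.simple i * cs.simple j) ^ n)⁻¹,
        e + ∑ k ∈ Finset.range (2 * n),
          if t = (cs.simple i * cs.simple j)⁻¹ ^ k * cs.simple j then 1 else 0) := by
  induction n with
  | zero =>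
    simp only [pow_zero, mul_zero, Finset.range_zero, Finset.sum_empty]
    change (t, e) = _
    simp
  | succ n ih =>
    rw [pow_succ']
    change cs.signedConj i (cs.signedConj j (((cs.signedConj i * cs.signedConj j) ^ n) (t, e))) = _
    rw [ih, mul_add_one, Finset.sum_range_succ, Finset.sum_range_succ]
    set ρ := cs.simple i * cs.simple j with hρ
    have hρi : ρ⁻¹ = cs.simple j * cs.simple i := by simp [hρ]
    have hconj : cs.simple j * ρ ^ n = ρ⁻¹ ^ n * cs.simple j := by
      have h : cs.simple j * ρ * (cs.simple j)⁻¹ = ρ⁻¹ := by simp [hρ, mul_assoc]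
      rw [← h, conj_pow]
      simp
    have h1 : ρ ^ n * t * (ρ ^ n)⁻¹ = cs.simple j ↔ t = ρ⁻¹ ^ (2 * n) * cs.simple j := by
      rw [two_mul, pow_add, mul_assoc (ρ⁻¹ ^ n), ← hconj, mul_inv_eq_iff_eq_mul,
        inv_pow, eq_inv_mul_iff_mul_eq]
    have h2 : cs.simple j * (ρ ^ n * t * (ρ ^ n)⁻¹) * cs.simple j = cs.simple i ↔
        t = ρ⁻¹ ^ (2 * n + 1) * cs.simple j := by
      have h3 : ρ⁻¹ ^ (2 * n + 1) * cs.simple j =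
          (ρ ^ n)⁻¹ * (cs.simple j * cs.simple i * cs.simple j) * ρ ^ n := by
        rw [mul_assoc, mul_assoc, hconj, ← hρi, two_mul, add_assoc, pow_add, pow_succ', inv_pow]
        simp only [mul_assoc]
      rw [h3]
      constructor
      · intro h
        rw [← h]
        simp [mul_assoc]
      · intro h
        rw [h]
        simp [mul_assoc]
    simp only [signedConj, h1, h2]
    ext
    · simp [hρ, pow_succ', mul_assoc]
    · simp only [add_assoc]

theorem isLiftable_signedConj : Mat.IsLiftable cs.signedConj := by
  classical
  intro i j
  funext ⟨t, e⟩
  rw [signedConj_mul_pow_apply, cs.simple_mul_simple_pow, two_mul, Finset.sum_range_add]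
  simp only [pow_add, inv_pow, cs.simple_mul_simple_pow]
  simp only [inv_one, one_mul, mul_one, CharTwo.add_self_eq_zero, add_zero]
  rfl

/-- The parity with which `t` occurs among the right inversions of `w`. -/
def rightInvParity (w t : W) : ZMod 2 :=
  (cs.lift ⟨cs.signedConj, cs.isLiftable_signedConj⟩ w (t, 0)).2

open Classical in
theorem lift_signedConj_wordProd (ω : List B) (t : W) (e : ZMod 2) :
    cs.lift ⟨cs.signedConj, cs.isLiftable_signedConj⟩ (cs.wordProd ω) (t, e) =
      (cs.wordProd ω * t * (cs.wordProd ω)⁻¹, e + (cs.rightInvSeq ω).count t) := by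
  induction ω with
  | nil =>
    rw [wordProd_nil, map_one]
    change (t, e) = _
    simp
  | cons i ω ih =>
    rw [wordProd_cons, map_mul, lift_apply_simple]
    change cs.signedConj i (cs.lift ⟨cs.signedConj, cs.isLiftable_signedConj⟩
      (cs.wordProd ω) (t, e)) = _
    have h : cs.wordProd ω * t * (cs.wordProd ω)⁻¹ = cs.simple i ↔
        (cs.wordProd ω)⁻¹ * cs.simple i * cs.wordProd ω = t := by
      rw [mul_inv_eq_iff_eq_mul, mul_assoc, inv_mul_eq_iff_eq_mul, eq_comm]
    rw [ih, signedConj, rightInvSeq, List.count_cons]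
    simp only [beq_iff_eq, h]
    ext
    · simp [mul_assoc]
    · push_cast
      simp only [add_assoc]

theorem rightInvParity_mul (x y t : W) : cs.rightInvParity (x * y) t =
    cs.rightInvParity y t + cs.rightInvParity x (y * t * y⁻¹) := by
  classical
  obtain ⟨ω, rfl⟩ := cs.wordProd_surjective x
  obtain ⟨ω', rfl⟩ := cs.wordProd_surjective y
  simp only [rightInvParity, map_mul]
  change (cs.lift ⟨cs.signedConj, cs.isLiftable_signedConj⟩ (cs.wordProd ω)
    (cs.lift ⟨cs.signedConj, cs.isLiftable_signedConj⟩ (cs.wordProd ω') (t, 0))).2 = _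
  simp only [lift_signedConj_wordProd, zero_add]

theorem length_mul_lt_of_rightInvParity_ne_zero {w t : W} (h : cs.rightInvParity w t ≠ 0) :
    cs.length (w * t) < cs.length w := by
  classical
  obtain ⟨ω, hω, rfl⟩ := cs.exists_isReduced w
  rw [rightInvParity, lift_signedConj_wordProd] at h
  refine (cs.isRightInversion_of_mem_rightInvSeq hω (t := t) ?_).2
  by_contra hmem
  exact h (by simp [List.count_eq_zero_of_not_mem hmem])

theorem rightInvParity_simple_ne_zero_iff {w : W} {i : B} :
    cs.rightInvParity w (cs.simple i) ≠ 0 ↔ cs.length (w * cs.simple i) < cs.length w := by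
  refine ⟨cs.length_mul_lt_of_rightInvParity_ne_zero, fun h h0 => ?_⟩
  have h1 : cs.rightInvParity (cs.simple i) (cs.simple i) = 1 := by
    simp [rightInvParity, lift_apply_simple, signedConj]
  have h2 := cs.rightInvParity_mul (w * cs.simple i) (cs.simple i) (cs.simple i)
  rw [h1] at h2
  simp only [simple_mul_simple_cancel_right, h0, inv_simple, simple_mul_simple_self,
    one_mul] at h2
  have h3 := cs.length_mul_lt_of_rightInvParity_ne_zero
    (w := w * cs.simple i) (t := cs.simple i) (by rintro h4; simp [h4] at h2)
  simp only [simple_mul_simple_cancel_right] at h3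
  omega

/-- The parity with which `t` occurs among the left inversions of `w`. -/
def leftInvParity (w t : W) : ZMod 2 := cs.rightInvParity w⁻¹ t

theorem leftInvParity_mul (x y t : W) : cs.leftInvParity (x * y) t =
    cs.leftInvParity x t + cs.leftInvParity y (x⁻¹ * t * x) := by
  simp [leftInvParity, rightInvParity_mul]

theorem leftInvParity_simple_ne_zero_iff {w : W} {i : B} :
    cs.leftInvParity w (cs.simple i) ≠ 0 ↔ cs.length (cs.simple i * w) < cs.length w := by
  rw [leftInvParity, rightInvParity_simple_ne_zero_iff, ← cs.length_inv (_ * _), cs.length_inv w]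
  simp

theorem length_conj_mul_lt_of_leftInvParity_ne_zero {w x : W} {i : B}
    (h : cs.leftInvParity w (x⁻¹ * cs.simple i * x) ≠ 0) :
    cs.length (x⁻¹ * cs.simple i * x * w) < cs.length w := by
  have := cs.length_mul_lt_of_rightInvParity_ne_zero h
  rw [cs.length_inv w, ← cs.length_inv (_ * _)] at this
  simpa [mul_assoc] using this

theorem simple_mul_eq_mul_simple_of_length_lt {w : W} {i j : B}
    (h1 : cs.length w < cs.length (cs.simple i * w))
    (h2 : cs.length (cs.simple i * w * cs.simple j) < cs.length (w * cs.simple j)) :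
    cs.simple i * w = w * cs.simple j := by
  rw [mul_assoc, ← leftInvParity_simple_ne_zero_iff, leftInvParity_mul] at h2
  have h3 : cs.leftInvParity w (cs.simple i) = 0 := by
    by_contra h
    have := cs.leftInvParity_simple_ne_zero_iff.1 h
    omega
  rw [h3, zero_add] at h2
  have h4 := cs.length_conj_mul_lt_of_leftInvParity_ne_zero h2
  rw [length_simple, Nat.lt_one_iff, length_eq_zero_iff, mul_eq_one_iff_eq_inv, inv_simple,
    mul_assoc, inv_mul_eq_iff_eq_mul] at h4
  exact h4

variable {cs} {i j : B} {m : ℕ}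

theorem altProd_simple_eq_swap_iff (hm : orderOf (cs.simple i * cs.simple j) = m) (k : ℕ) :
    altProd (cs.simple i) (cs.simple j) k = altProd (cs.simple j) (cs.simple i) k ↔ m ∣ k := by
  rw [altProd_eq_swap_iff (cs.simple_mul_simple_self i) (cs.simple_mul_simple_self j),
    ← orderOf_dvd_iff_pow_eq_one, hm]

theorem orderOf_simple_mul_simple_swap (hm : orderOf (cs.simple i * cs.simple j) = m) :
    orderOf (cs.simple j * cs.simple i) = m := by
  rw [← hm, ← orderOf_inv]
  simp

theorem leftInvParity_altProd (hm : orderOf (cs.simple i * cs.simple j) = m) {k : ℕ} (hk : k < m) :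
    cs.leftInvParity (altProd (cs.simple j) (cs.simple i) k) (cs.simple i) = 0 := by
  induction k with
  | zero =>
    by_contra h
    have := cs.leftInvParity_simple_ne_zero_iff.1 h
    simp at this
  | succ k ih =>
    obtain ⟨r, hr⟩ : ∃ r, cs.simple r = if Even k then cs.simple j else cs.simple i := by
      split_ifs <;> exact ⟨_, rfl⟩
    rw [altProd_succ_right, ← hr, leftInvParity_mul, ih (by omega), zero_add]
    by_contra h
    have h1 := cs.length_conj_mul_lt_of_leftInvParity_ne_zero h
    rw [length_simple, Nat.lt_one_iff, length_eq_zero_iff, mul_eq_one_iff_eq_inv, inv_simple,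
      mul_assoc, inv_mul_eq_iff_eq_mul, ← altProd_succ, hr, ← altProd_succ_right,
      altProd_simple_eq_swap_iff hm] at h1
    exact absurd (Nat.le_of_dvd (Nat.succ_pos k) h1) (by omega)

theorem length_altProd_mul_of_minimal (hm : orderOf (cs.simple i * cs.simple j) = m) {d : W}
    (hd : ∀ x ∈ Subgroup.closure {cs.simple i, cs.simple j}, cs.length d ≤ cs.length (x * d))
    {k : ℕ} (hk : k ≤ m) :
    cs.length (altProd (cs.simple i) (cs.simple j) k * d) = cs.length d + k := by
  induction k generalizing i j with
  | zero => simp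
  | succ k ih =>
    have hmem : altProd (cs.simple j) (cs.simple i) k ∈
        Subgroup.closure {cs.simple i, cs.simple j} := by
      rw [Set.pair_comm]
      exact altProd_mem_closure _ _ k
    have h := ih (orderOf_simple_mul_simple_swap hm) (by rwa [Set.pair_comm]) (by omega)
    rw [altProd_succ, mul_assoc]
    rcases cs.length_simple_mul (altProd (cs.simple j) (cs.simple i) k * d) i with h1 | h1
    · omega
    · exfalso
      have h2 := cs.leftInvParity_simple_ne_zero_iff.2
        (show _ < _ by rw [← h1]; exact Nat.lt_succ_self _)
      rw [leftInvParity_mul, leftInvParity_altProd hm (by omega), zero_add] at h2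
      have h3 := cs.length_conj_mul_lt_of_leftInvParity_ne_zero h2
      refine absurd (hd _ ?_) (not_le.2 h3)
      exact mul_mem (mul_mem (inv_mem hmem) (Subgroup.subset_closure (by simp))) hmem

theorem length_altProd_mul (hm : orderOf (cs.simple i * cs.simple j) = m) (hm0 : 0 < m) {d : W}
    (hi : cs.length d < cs.length (cs.simple i * d))
    (hj : cs.length d < cs.length (cs.simple j * d)) {k : ℕ} (hk : k ≤ m) :
    cs.length (altProd (cs.simple i) (cs.simple j) k * d) = cs.length d + k := by
  refine length_altProd_mul_of_minimal hm ?_ hk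
  have hi2 := cs.simple_mul_simple_self i
  have hj2 := cs.simple_mul_simple_self j
  obtain ⟨x, hx, hmin⟩ := exists_minimalFor_of_wellFoundedLT
    (· ∈ Subgroup.closure {cs.simple i, cs.simple j}) (fun x => cs.length (x * d)) ⟨1, one_mem _⟩
  have hmin' : ∀ y ∈ Subgroup.closure {cs.simple i, cs.simple j},
      cs.length (x * d) ≤ cs.length (y * (x * d)) := by
    intro y hy
    rw [← mul_assoc]
    exact (le_total _ _).elim id fun h => hmin (mul_mem hy hx) h
  obtain ⟨k, hk, h⟩ := exists_altProd_of_mem_closure_pair hi2 hj2 hm0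
    (hm ▸ pow_orderOf_eq_one _) (inv_mem hx)
  cases k with
  | zero =>
    obtain rfl : x = 1 := by simpa using h
    simpa using hmin'
  | succ k =>
    exfalso
    have hm' := orderOf_simple_mul_simple_swap hm
    have hmin'' := hmin'
    rw [Set.pair_comm] at hmin''
    rcases h with h | h
    · have h1 := length_altProd_mul_of_minimal hm hmin' hk
      have h2 := length_altProd_mul_of_minimal hm' hmin'' (by omega : k ≤ m)
      have h3 : cs.simple i * d = altProd (cs.simple j) (cs.simple i) k * (x * d) := by
        rw [← cs.simple_mul_simple_cancel_left (w := altProd _ _ k * _) i, ← mul_assoc _ _ (x * d),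
          ← altProd_succ, ← h, inv_mul_cancel_left]
      rw [← h, inv_mul_cancel_left] at h1
      rw [← h3] at h2
      omega
    · have h1 := length_altProd_mul_of_minimal hm' hmin'' hk
      have h2 := length_altProd_mul_of_minimal hm hmin' (by omega : k ≤ m)
      have h3 : cs.simple j * d = altProd (cs.simple i) (cs.simple j) k * (x * d) := by
        rw [← cs.simple_mul_simple_cancel_left (w := altProd _ _ k * _) j, ← mul_assoc _ _ (x * d),
          ← altProd_succ, ← h, inv_mul_cancel_left]
      rw [← h, inv_mul_cancel_left] at h1
      rw [← h3] at h2
      omega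

section TwistedInvolutions

variable {star : W ≃* W}

theorem length_star (hstar2 : ∀ w : W, star (star w) = w)
    (hstarS : ∀ i : B, ∃ j : B, star (cs.simple i) = cs.simple j) (w : W) :
    cs.length (star w) = cs.length w := by
  choose σ hσ using hstarS
  have hle : ∀ w, cs.length (star w) ≤ cs.length w := by
    intro w
    obtain ⟨ω, hω, rfl⟩ := cs.exists_isReduced w
    have h : star (cs.wordProd ω) = cs.wordProd (ω.map σ) := by
      simp [wordProd, map_list_prod, Function.comp_def, hσ]
    rw [h, hω.eq]
    simpa using cs.length_wordProd_le (ω.map σ)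
  exact le_antisymm (hle w) (by simpa [hstar2] using hle (star w))

theorem inv_star_simple (i : B) : (star (cs.simple i))⁻¹ = star (cs.simple i) := by
  rw [← map_inv, inv_simple]

theorem star_simple_mul_self (i : B) : star (cs.simple i) * star (cs.simple i) = 1 := by
  rw [← map_mul, simple_mul_simple_self, map_one]

theorem length_mul_inv_star (hstar2 : ∀ w : W, star (star w) = w)
    (hstarS : ∀ i : B, ∃ j : B, star (cs.simple i) = cs.simple j) {d : W} (hd : d ∈ Istar star)
    (x : W) : cs.length (d * (star x)⁻¹) = cs.length (x * d) := by
  rw [← cs.length_inv, ← length_star hstar2 hstarS]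
  have hd' : star d = d⁻¹ := hd
  simp [hstar2, hd']

theorem mul_mul_inv_star_mem {w : W} (hstar2 : ∀ w : W, star (star w) = w)
    (hw : w ∈ Istar star) (x : W) : x * w * (star x)⁻¹ ∈ Istar star := by
  have hw' : star w = w⁻¹ := hw
  simp [Istar, hstar2, hw', mul_assoc]

theorem simple_mul_mem {w : W} (hw : w ∈ Istar star)
    (h : cs.simple i * w = w * star (cs.simple i)) : cs.simple i * w ∈ Istar star := by
  have hw' : star w = w⁻¹ := hw
  change star (cs.simple i * w) = (cs.simple i * w)⁻¹
  rw [map_mul, hw', h, mul_inv_rev, inv_star_simple]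

theorem conj_mul_eq_of_length_lt (hstar2 : ∀ w : W, star (star w) = w)
    (hstarS : ∀ i : B, ∃ j : B, star (cs.simple i) = cs.simple j) {d : W} (hd : d ∈ Istar star)
    {r a : B} {x : W}
    (h1 : cs.length (d * (star x)⁻¹) < cs.length (cs.simple r * (d * (star x)⁻¹)))
    (h2 : cs.length (cs.simple r * (d * (star (cs.simple a * x))⁻¹)) <
      cs.length (d * (star (cs.simple a * x))⁻¹)) :
    x⁻¹ * cs.simple a * x * d = d * star (cs.simple r) := by
  obtain ⟨a', ha'⟩ := hstarS a
  have hd' : star d = d⁻¹ := hd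
  rw [map_mul, mul_inv_rev, inv_star_simple, ha', ← mul_assoc d, ← mul_assoc] at h2
  have h3 := simple_mul_eq_mul_simple_of_length_lt cs h1 h2
  rw [← ha'] at h3
  have h4 := congrArg (fun w => (star w)⁻¹) h3
  simp only [map_mul, map_inv, hstar2, hd', mul_inv_rev, inv_inv, inv_simple,
    inv_star_simple] at h4
  rw [mul_assoc, mul_assoc, inv_mul_eq_iff_eq_mul, ← h4, mul_assoc]

theorem eq_simple_of_mul_eq_mul_star (hm : orderOf (cs.simple i * cs.simple j) = m) (hm0 : 0 < m)
    (hstarS : ∀ i : B, ∃ j : B, star (cs.simple i) = cs.simple j) {d : W}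
    (hi : cs.length d < cs.length (cs.simple i * d))
    (hj : cs.length d < cs.length (cs.simple j * d)) {x : W} {r : B}
    (hx : x ∈ Subgroup.closure {cs.simple i, cs.simple j})
    (h : x * d = d * star (cs.simple r)) : x = cs.simple i ∨ x = cs.simple j := by
  obtain ⟨r', hr'⟩ := hstarS r
  have h1 : cs.length (x * d) = cs.length d + 1 ∨ cs.length (x * d) + 1 = cs.length d := by
    rw [h, hr']
    exact cs.length_mul_simple d r'
  obtain ⟨k, hk, hx'⟩ := exists_altProd_of_mem_closure_pair (cs.simple_mul_simple_self i)
    (cs.simple_mul_simple_self j) hm0 (hm ▸ pow_orderOf_eq_one _) hx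
  rcases hx' with rfl | rfl
  · rw [length_altProd_mul hm hm0 hi hj hk] at h1
    obtain rfl : k = 1 := by omega
    simp [altProd]
  · rw [length_altProd_mul (orderOf_simple_mul_simple_swap hm) hm0 hj hi hk] at h1
    obtain rfl : k = 1 := by omega
    simp [altProd]

/-- Neither of the simple reflections of index `i` and `j` is a left descent of `d`. -/
def NoDescent (cs : CoxeterSystem Mat W) (i j : B) (d : W) : Prop :=
  cs.length d < cs.length (cs.simple i * d) ∧ cs.length d < cs.length (cs.simple j * d)

theorem noDescent_step (hm : orderOf (cs.simple i * cs.simple j) = m) (hm0 : 0 < m)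
    (hstar2 : ∀ w : W, star (star w) = w)
    (hstarS : ∀ i : B, ∃ j : B, star (cs.simple i) = cs.simple j) {d : W} (hd : d ∈ Istar star)
    (hnd : NoDescent cs i j d) {x : W} (hx : x ∈ Subgroup.closure {cs.simple i, cs.simple j})
    (hxd : NoDescent cs i j (d * (star x)⁻¹))
    (h : ∀ y, y = cs.simple i ∨ y = cs.simple j → ∀ r, r = i ∨ r = j →
      y * d = d * star (cs.simple r) → cs.simple i * x ≠ x * y) :
    NoDescent cs i j (d * (star (cs.simple i * x))⁻¹) := by
  have key : ∀ r, r = i ∨ r = j →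
      cs.length (d * (star x)⁻¹) < cs.length (cs.simple r * (d * (star x)⁻¹)) →
      cs.length (d * (star (cs.simple i * x))⁻¹) <
        cs.length (cs.simple r * (d * (star (cs.simple i * x))⁻¹)) := by
    intro r hr h1
    by_contra h2
    have h3 := conj_mul_eq_of_length_lt hstar2 hstarS hd h1
      (lt_of_le_of_ne (not_lt.1 h2) (cs.length_simple_mul_ne _ r))
    have hmem : x⁻¹ * cs.simple i * x ∈ Subgroup.closure {cs.simple i, cs.simple j} :=
      mul_mem (mul_mem (inv_mem hx) (Subgroup.subset_closure (by simp))) hx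
    refine h _ (eq_simple_of_mul_eq_mul_star hm hm0 hstarS hnd.1 hnd.2 hmem h3) r hr h3 ?_
    simp [mul_assoc]
  exact ⟨key i (Or.inl rfl) hxd.1, key j (Or.inr rfl) hxd.2⟩

theorem noDescent_mul_inv_star_of_free (hm : orderOf (cs.simple i * cs.simple j) = m) (hm0 : 0 < m)
    (hstar2 : ∀ w : W, star (star w) = w)
    (hstarS : ∀ i : B, ∃ j : B, star (cs.simple i) = cs.simple j) {d : W} (hd : d ∈ Istar star)
    (hnd : NoDescent cs i j d)
    (h : ∀ y, y = cs.simple i ∨ y = cs.simple j → ∀ r, r = i ∨ r = j →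
      y * d ≠ d * star (cs.simple r)) (k : ℕ) :
    NoDescent cs i j (d * (star (altProd (cs.simple i) (cs.simple j) k))⁻¹) := by
  induction k generalizing i j with
  | zero => simpa using hnd
  | succ k ih =>
    refine noDescent_step hm hm0 hstar2 hstarS hd hnd ?_ (ih (orderOf_simple_mul_simple_swap hm)
      hnd.symm fun y hy r hr => h y hy.symm r hr.symm).symm
      fun y hy r hr h1 => absurd h1 (h y hy r hr)
    rw [Set.pair_comm]
    exact altProd_mem_closure _ _ k

theorem noDescent_mul_inv_star_of_unique (hm : orderOf (cs.simple i * cs.simple j) = m)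
    (hm0 : 0 < m) (hstar2 : ∀ w : W, star (star w) = w)
    (hstarS : ∀ i : B, ∃ j : B, star (cs.simple i) = cs.simple j) {d : W} (hd : d ∈ Istar star)
    (hnd : NoDescent cs i j d) {c : W}
    (h : ∀ y, y = cs.simple i ∨ y = cs.simple j → ∀ r, r = i ∨ r = j →
      y * d = d * star (cs.simple r) → y = c) {k : ℕ} (hk : k < m)
    (hc : altProd (cs.simple i) (cs.simple j) k * c =
      altProd (cs.simple i) (cs.simple j) (k + 1)) :
    NoDescent cs i j (d * (star (altProd (cs.simple i) (cs.simple j) k))⁻¹) := by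
  induction k generalizing i j with
  | zero => simpa using hnd
  | succ k ih =>
    have hc' : altProd (cs.simple j) (cs.simple i) k * c =
        altProd (cs.simple j) (cs.simple i) (k + 1) := by
      rwa [altProd_succ, altProd_succ _ _ (k + 1), mul_assoc, mul_right_inj] at hc
    refine noDescent_step hm hm0 hstar2 hstarS hd hnd ?_ (ih (orderOf_simple_mul_simple_swap hm)
      hnd.symm (fun y hy r hr => h y hy.symm r hr.symm) (by omega) hc').symm
      fun y hy r hr h1 h2 => ?_
    · rw [Set.pair_comm]
      exact altProd_mem_closure _ _ k
    · rw [h y hy r hr h1, hc', ← altProd_succ, altProd_simple_eq_swap_iff hm] at h2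
      exact absurd (Nat.le_of_dvd (Nat.succ_pos k) h2) (by omega)

theorem length_altProd_mul_mul (hm : orderOf (cs.simple i * cs.simple j) = m) (hm0 : 0 < m)
    (hstar2 : ∀ w : W, star (star w) = w)
    (hstarS : ∀ i : B, ∃ j : B, star (cs.simple i) = cs.simple j) {d x : W} (hd : d ∈ Istar star)
    (hx : NoDescent cs i j (d * (star x)⁻¹)) {k : ℕ} (hk : k ≤ m) :
    cs.length (altProd (cs.simple i) (cs.simple j) k * d * (star x)⁻¹) =
      cs.length (x * d) + k := by
  rw [mul_assoc, length_altProd_mul hm hm0 hx.1 hx.2 hk, length_mul_inv_star hstar2 hstarS hd]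

theorem length_mul_star_simple (hstar2 : ∀ w : W, star (star w) = w)
    (hstarS : ∀ i : B, ∃ j : B, star (cs.simple i) = cs.simple j) {w : W} (hw : w ∈ Istar star) :
    cs.length (w * star (cs.simple i)) = cs.length (cs.simple i * w) := by
  rw [← length_mul_inv_star hstar2 hstarS hw, inv_star_simple]

theorem length_simple_conj_of_lt (hstar2 : ∀ w : W, star (star w) = w)
    (hstarS : ∀ i : B, ∃ j : B, star (cs.simple i) = cs.simple j) {w : W} (hw : w ∈ Istar star)
    (hlt : cs.length w < cs.length (cs.simple i * w))
    (hne : cs.simple i * w ≠ w * star (cs.simple i)) :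
    cs.length (cs.simple i * w * star (cs.simple i)) = cs.length w + 2 := by
  have hlen := length_mul_star_simple (i := i) hstar2 hstarS hw
  obtain ⟨i', hi'⟩ := hstarS i
  rw [hi'] at hne hlen ⊢
  have h1 := cs.length_simple_mul w i
  have h2 := cs.length_simple_mul (w * cs.simple i') i
  rw [← mul_assoc] at h2
  by_contra h
  exact hne (simple_mul_eq_mul_simple_of_length_lt cs hlt (by omega))

theorem length_simple_conj_of_gt (hstar2 : ∀ w : W, star (star w) = w)
    (hstarS : ∀ i : B, ∃ j : B, star (cs.simple i) = cs.simple j) {w : W} (hw : w ∈ Istar star)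
    (hgt : cs.length (cs.simple i * w) < cs.length w)
    (hne : cs.simple i * w ≠ w * star (cs.simple i)) :
    cs.length (cs.simple i * w * star (cs.simple i)) + 2 = cs.length w := by
  have hlen := length_mul_star_simple (i := i) hstar2 hstarS hw
  obtain ⟨i', hi'⟩ := hstarS i
  rw [hi'] at hne hlen ⊢
  have h1 := cs.length_simple_mul w i
  have h2 := cs.length_simple_mul (w * cs.simple i') i
  rw [← mul_assoc] at h2
  by_contra h
  have h3 := simple_mul_eq_mul_simple_of_length_lt cs (w := cs.simple i * w) (i := i) (j := i')
    (by simpa using hgt) (by simp only [← mul_assoc, simple_mul_simple_self, one_mul]; omega)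
  apply hne
  rw [simple_mul_simple_cancel_left] at h3
  nth_rw 2 [h3]
  simp

open Classical in
/-- The basis element of `InvolModule star` attached to `w`, with junk value `0` when `w` is not
a twisted involution. -/
def basisVec (star : W ≃* W) (w : W) : InvolModule star :=
  if h : w ∈ Istar star then single ⟨w, h⟩ 1 else 0

theorem basisVec_of_mem {w : W} (h : w ∈ Istar star) : basisVec star w = single ⟨w, h⟩ 1 :=
  dif_pos h

theorem end_ext {f g : Module.End R (InvolModule star)}
    (h : ∀ w ∈ Istar star, f (basisVec star w) = g (basisVec star w)) : f = g := by
  refine Finsupp.lhom_ext' fun w => LinearMap.ext_ring ?_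
  simpa [basisVec_of_mem w.2] using h w w.2

theorem conj_star_simple_mem (hstar2 : ∀ w : W, star (star w) = w) {w : W}
    (hw : w ∈ Istar star) : cs.simple i * w * star (cs.simple i) ∈ Istar star := by
  simpa only [inv_star_simple] using mul_mul_inv_star_mem hstar2 hw (cs.simple i)

section Operators

variable {Ts Tt : Module.End R (InvolModule star)}

theorem apply_basisVec_of_comm_of_lt (hTs : IsTs cs star i Ts) {w : W} (hw : w ∈ Istar star)
    (hc : cs.simple i * w = w * star (cs.simple i))
    (hl : cs.length w < cs.length (cs.simple i * w)) :
    Ts (basisVec star w) = u • basisVec star w + (u + 1) • basisVec star (cs.simple i * w) := by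
  rw [basisVec_of_mem hw, basisVec_of_mem (simple_mul_mem hw hc)]
  exact ((hTs ⟨w, hw⟩).1 ⟨_, simple_mul_mem hw hc⟩ rfl hc).1 hl

theorem apply_basisVec_of_comm_of_gt (hTs : IsTs cs star i Ts) {w : W} (hw : w ∈ Istar star)
    (hc : cs.simple i * w = w * star (cs.simple i))
    (hl : cs.length (cs.simple i * w) < cs.length w) :
    Ts (basisVec star w) = (u ^ 2 - u - 1) • basisVec star w +
      (u ^ 2 - u) • basisVec star (cs.simple i * w) := by
  rw [basisVec_of_mem hw, basisVec_of_mem (simple_mul_mem hw hc)]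
  exact ((hTs ⟨w, hw⟩).1 ⟨_, simple_mul_mem hw hc⟩ rfl hc).2 hl

theorem apply_basisVec_of_ne_of_lt (hTs : IsTs cs star i Ts) (hstar2 : ∀ w : W, star (star w) = w)
    {w : W} (hw : w ∈ Istar star) (hc : cs.simple i * w ≠ w * star (cs.simple i))
    (hl : cs.length w < cs.length (cs.simple i * w)) :
    Ts (basisVec star w) = basisVec star (cs.simple i * w * star (cs.simple i)) := by
  rw [basisVec_of_mem hw, basisVec_of_mem (conj_star_simple_mem hstar2 hw)]
  exact ((hTs ⟨w, hw⟩).2 ⟨_, conj_star_simple_mem hstar2 hw⟩ rfl hc).1 hl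

theorem apply_basisVec_of_ne_of_gt (hTs : IsTs cs star i Ts) (hstar2 : ∀ w : W, star (star w) = w)
    {w : W} (hw : w ∈ Istar star) (hc : cs.simple i * w ≠ w * star (cs.simple i))
    (hl : cs.length (cs.simple i * w) < cs.length w) :
    Ts (basisVec star w) = (u ^ 2 - 1 : R) • basisVec star w +
      (u ^ 2 : R) • basisVec star (cs.simple i * w * star (cs.simple i)) := by
  rw [basisVec_of_mem hw, basisVec_of_mem (conj_star_simple_mem hstar2 hw)]
  exact ((hTs ⟨w, hw⟩).2 ⟨_, conj_star_simple_mem hstar2 hw⟩ rfl hc).2 hl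

theorem length_conj_star_simple_le (hstarS : ∀ i : B, ∃ j : B, star (cs.simple i) = cs.simple j)
    (w : W) :
    cs.length (cs.simple i * w * star (cs.simple i)) ≤ cs.length (cs.simple i * w) + 1 := by
  obtain ⟨i', hi'⟩ := hstarS i
  rw [hi']
  have := cs.length_mul_simple (cs.simple i * w) i'
  omega

theorem apply_basisVec_of_length_conj (hTs : IsTs cs star i Ts)
    (hstar2 : ∀ w : W, star (star w) = w)
    (hstarS : ∀ i : B, ∃ j : B, star (cs.simple i) = cs.simple j) {w : W} (hw : w ∈ Istar star)
    (hl : cs.length (cs.simple i * w * star (cs.simple i)) = cs.length w + 2) :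
    Ts (basisVec star w) = basisVec star (cs.simple i * w * star (cs.simple i)) := by
  refine apply_basisVec_of_ne_of_lt hTs hstar2 hw (fun h => ?_) ?_
  · rw [h, mul_assoc, star_simple_mul_self, mul_one] at hl
    omega
  · have := length_conj_star_simple_le (i := i) hstarS w
    omega

/-- The quadratic relation `(T_s + 1) (T_s - u²) = 0`. -/
theorem mul_self_eq (hTs : IsTs cs star i Ts) (hstar2 : ∀ w : W, star (star w) = w)
    (hstarS : ∀ i : B, ∃ j : B, star (cs.simple i) = cs.simple j) :
    Ts * Ts = (u ^ 2 - 1 : R) • Ts + (u ^ 2 : R) • 1 := by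
  refine end_ext fun w hw => ?_
  have hlen := lt_or_gt_of_ne (cs.length_simple_mul_ne w i).symm
  have hss : cs.simple i * (cs.simple i * w) = w := by simp
  simp only [Module.End.mul_apply, LinearMap.add_apply, LinearMap.smul_apply, Module.End.one_apply]
  by_cases hc : cs.simple i * w = w * star (cs.simple i)
  · have hc' : cs.simple i * (cs.simple i * w) = cs.simple i * w * star (cs.simple i) := by
      rw [hc, ← mul_assoc, hc]
    have hw' := simple_mul_mem hw hc
    rcases hlen with h | h
    · have h1 := apply_basisVec_of_comm_of_lt hTs hw hc h
      have h2 := apply_basisVec_of_comm_of_gt hTs hw' hc' (by rwa [hss])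
      rw [hss] at h2
      rw [h1, map_add, map_smul, map_smul, h1, h2]
      module
    · have h1 := apply_basisVec_of_comm_of_gt hTs hw hc h
      have h2 := apply_basisVec_of_comm_of_lt hTs hw' hc' (by rwa [hss])
      rw [hss] at h2
      rw [h1, map_add, map_smul, map_smul, h1, h2]
      module
  · have hw' := conj_star_simple_mem (cs := cs) (i := i) hstar2 hw
    have hconj : cs.simple i * (cs.simple i * w * star (cs.simple i)) * star (cs.simple i) = w := by
      rw [mul_assoc (cs.simple i) w, ← mul_assoc (cs.simple i), simple_mul_simple_self, one_mul,
        mul_assoc, star_simple_mul_self, mul_one]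
    have hc' : cs.simple i * (cs.simple i * w * star (cs.simple i)) ≠
        cs.simple i * w * star (cs.simple i) * star (cs.simple i) := by
      rw [mul_assoc _ (star (cs.simple i)), star_simple_mul_self, mul_one,
        mul_assoc (cs.simple i) w, ← mul_assoc (cs.simple i), simple_mul_simple_self, one_mul]
      exact Ne.symm hc
    have hl : cs.length (cs.simple i * (cs.simple i * w * star (cs.simple i))) =
        cs.length (cs.simple i * w) := by
      rw [mul_assoc (cs.simple i) w, ← mul_assoc (cs.simple i), simple_mul_simple_self, one_mul,
        length_mul_star_simple hstar2 hstarS hw]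
    have hlw := cs.length_simple_mul w i
    rcases hlen with h | h
    · have h0 := length_simple_conj_of_lt hstar2 hstarS hw h hc
      have h1 := apply_basisVec_of_ne_of_lt hTs hstar2 hw hc h
      have h2 := apply_basisVec_of_ne_of_gt hTs hstar2 hw' hc' (by omega)
      rw [hconj] at h2
      rw [h1, h2]
    · have h0 := length_simple_conj_of_gt hstar2 hstarS hw h hc
      have h1 := apply_basisVec_of_ne_of_gt hTs hstar2 hw hc h
      have h2 := apply_basisVec_of_ne_of_lt hTs hstar2 hw' hc' (by omega)
      rw [hconj] at h2
      rw [h1, map_add, map_smul, map_smul, h1, h2]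

theorem length_altProd_conj_le (hstarS : ∀ i : B, ∃ j : B, star (cs.simple i) = cs.simple j)
    (i j : B) (k : ℕ) (w : W) :
    cs.length (altProd (cs.simple i) (cs.simple j) k * w *
      (star (altProd (cs.simple i) (cs.simple j) k))⁻¹) ≤ cs.length w + 2 * k := by
  induction k generalizing i j with
  | zero => simp
  | succ k ih =>
    have h1 := ih j i
    set z := altProd (cs.simple j) (cs.simple i) k * w *
      (star (altProd (cs.simple j) (cs.simple i) k))⁻¹ with hz
    have h2 := length_conj_star_simple_le (i := i) hstarS z
    have h3 := cs.length_simple_mul z i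
    have h4 : altProd (cs.simple i) (cs.simple j) (k + 1) * w *
        (star (altProd (cs.simple i) (cs.simple j) (k + 1)))⁻¹ =
        cs.simple i * z * star (cs.simple i) := by
      simp only [hz, altProd_succ, map_mul, mul_inv_rev, inv_star_simple, mul_assoc]
    rw [h4]
    omega

theorem altProd_apply_basisVec (hTs : IsTs cs star i Ts) (hTt : IsTs cs star j Tt)
    (hstar2 : ∀ w : W, star (star w) = w)
    (hstarS : ∀ i : B, ∃ j : B, star (cs.simple i) = cs.simple j) {w : W} (hw : w ∈ Istar star)
    {k : ℕ} (hl : cs.length (altProd (cs.simple i) (cs.simple j) k * w *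
      (star (altProd (cs.simple i) (cs.simple j) k))⁻¹) = cs.length w + 2 * k) :
    altProd Ts Tt k (basisVec star w) = basisVec star (altProd (cs.simple i) (cs.simple j) k * w *
      (star (altProd (cs.simple i) (cs.simple j) k))⁻¹) := by
  induction k generalizing i j Ts Tt with
  | zero => simp
  | succ k ih =>
    have h4 : altProd (cs.simple i) (cs.simple j) (k + 1) * w *
        (star (altProd (cs.simple i) (cs.simple j) (k + 1)))⁻¹ =
        cs.simple i * (altProd (cs.simple j) (cs.simple i) k * w *
      (star (altProd (cs.simple j) (cs.simple i) k))⁻¹) * star (cs.simple i) := by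
      simp only [altProd_succ, map_mul, mul_inv_rev, inv_star_simple, mul_assoc]
    have h1 := length_altProd_conj_le hstarS j i k w
    rw [h4] at hl ⊢
    have h2 := length_conj_star_simple_le (i := i) hstarS
      (altProd (cs.simple j) (cs.simple i) k * w * (star (altProd (cs.simple j) (cs.simple i) k))⁻¹)
    have h3 := cs.length_simple_mul (altProd (cs.simple j) (cs.simple i) k * w *
      (star (altProd (cs.simple j) (cs.simple i) k))⁻¹) i
    rw [altProd_succ, Module.End.mul_apply, ih hTt hTs (by omega)]
    exact apply_basisVec_of_length_conj hTs hstar2 hstarS (mul_mul_inv_star_mem hstar2 hw _)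
      (by omega)

theorem altProd_conj_of_free (hm : orderOf (cs.simple i * cs.simple j) = m) (hm0 : 0 < m)
    (hTs : IsTs cs star i Ts) (hTt : IsTs cs star j Tt) (hstar2 : ∀ w : W, star (star w) = w)
    (hstarS : ∀ i : B, ∃ j : B, star (cs.simple i) = cs.simple j) {d : W} (hd : d ∈ Istar star)
    (hnd : NoDescent cs i j d)
    (h : ∀ y, y = cs.simple i ∨ y = cs.simple j → ∀ r, r = i ∨ r = j →
      y * d ≠ d * star (cs.simple r)) :
    altProd Ts Tt m (basisVec star d) =
      basisVec star (altProd (cs.simple i) (cs.simple j) m * d *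
        (star (altProd (cs.simple i) (cs.simple j) m))⁻¹) := by
  refine altProd_apply_basisVec hTs hTt hstar2 hstarS hd ?_
  rw [length_altProd_mul_mul hm hm0 hstar2 hstarS hd
    (noDescent_mul_inv_star_of_free hm hm0 hstar2 hstarS hd hnd h m) le_rfl,
    length_altProd_mul hm hm0 hnd.1 hnd.2 le_rfl]
  omega

theorem altProd_simple_eq_swap (hm : orderOf (cs.simple i * cs.simple j) = m) :
    altProd (cs.simple i) (cs.simple j) m = altProd (cs.simple j) (cs.simple i) m :=
  (altProd_simple_eq_swap_iff hm m).2 dvd_rfl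

theorem altProd_apply_eq_of_free (hm : orderOf (cs.simple i * cs.simple j) = m) (hm0 : 0 < m)
    (hTs : IsTs cs star i Ts) (hTt : IsTs cs star j Tt) (hstar2 : ∀ w : W, star (star w) = w)
    (hstarS : ∀ i : B, ∃ j : B, star (cs.simple i) = cs.simple j) {d : W} (hd : d ∈ Istar star)
    (hnd : NoDescent cs i j d)
    (h : ∀ y, y = cs.simple i ∨ y = cs.simple j → ∀ r, r = i ∨ r = j →
      y * d ≠ d * star (cs.simple r)) :
    altProd Ts Tt m (basisVec star d) = altProd Tt Ts m (basisVec star d) := by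
  rw [altProd_conj_of_free hm hm0 hTs hTt hstar2 hstarS hd hnd h,
    altProd_conj_of_free (orderOf_simple_mul_simple_swap hm) hm0 hTt hTs hstar2 hstarS hd hnd.symm
      fun y hy r hr => h y hy.symm r hr.symm, altProd_simple_eq_swap hm]

theorem altProd_apply_eq_of_unique {n : ℕ} (hm : orderOf (cs.simple i * cs.simple j) = n + 1)
    (hTs : IsTs cs star i Ts) (hTt : IsTs cs star j Tt) (hstar2 : ∀ w : W, star (star w) = w)
    (hstarS : ∀ i : B, ∃ j : B, star (cs.simple i) = cs.simple j) {d : W} (hd : d ∈ Istar star)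
    (hnd : NoDescent cs i j d) {e : B} {Te : Module.End R (InvolModule star)}
    (hTe : IsTs cs star e Te) (hed : cs.simple e * d = d * star (cs.simple e))
    (hle : cs.length d < cs.length (cs.simple e * d))
    (h : ∀ y, y = cs.simple i ∨ y = cs.simple j → ∀ r, r = i ∨ r = j →
      y * d = d * star (cs.simple r) → y = cs.simple e)
    (hc : altProd (cs.simple i) (cs.simple j) n * cs.simple e =
      altProd (cs.simple i) (cs.simple j) (n + 1))
    (hT : altProd Ts Tt n * Te = altProd Ts Tt (n + 1)) :
    altProd Ts Tt (n + 1) (basisVec star d) = altProd Tt Ts (n + 1) (basisVec star d) := by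
  have hn0 := Nat.succ_pos n
  set x := altProd (cs.simple i) (cs.simple j) n with hx
  have hnx := noDescent_mul_inv_star_of_unique hm hn0 hstar2 hstarS hd hnd h (Nat.lt_succ_self n) hc
  have hlx : cs.length (x * d) = cs.length d + n :=
    length_altProd_mul hm hn0 hnd.1 hnd.2 (Nat.le_succ n)
  have hl1 : cs.length (x * d * (star x)⁻¹) = cs.length d + 2 * n := by
    rw [length_altProd_mul_mul hm hn0 hstar2 hstarS hd hnx (Nat.le_succ n), hlx]
    omega
  have hxe : x * (cs.simple e * d) * (star x)⁻¹ =
      altProd (cs.simple i) (cs.simple j) (n + 1) * d * (star x)⁻¹ := by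
    rw [← mul_assoc x, hc]
  have hl2 : cs.length (x * (cs.simple e * d) * (star x)⁻¹) = cs.length d + 2 * n + 1 := by
    rw [hxe, length_altProd_mul_mul hm hn0 hstar2 hstarS hd hnx le_rfl, hlx]
    omega
  have hled : cs.length (cs.simple e * d) = cs.length d + 1 := by
    have := cs.length_simple_mul d e
    omega
  have hjx : cs.simple j * x = x * cs.simple e := by
    rw [hc, altProd_simple_eq_swap hm, altProd_succ]
  have h1 : cs.simple j * (x * d * (star x)⁻¹) = x * (cs.simple e * d) * (star x)⁻¹ := by
    simp only [← mul_assoc, hjx]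
  have h2 : x * d * (star x)⁻¹ * star (cs.simple j) = x * (cs.simple e * d) * (star x)⁻¹ := by
    have h3 : (star x)⁻¹ * star (cs.simple j) = star (cs.simple e) * (star x)⁻¹ := by
      rw [← inv_star_simple j, ← inv_star_simple e, ← mul_inv_rev, ← mul_inv_rev, ← map_mul,
        ← map_mul, hjx]
    rw [mul_assoc, h3, hed]
    simp only [mul_assoc]
  rw [← hT, Module.End.mul_apply, apply_basisVec_of_comm_of_lt hTe hd hed hle, map_add, map_smul,
    map_smul, altProd_succ Tt, Module.End.mul_apply,
    altProd_apply_basisVec hTs hTt hstar2 hstarS hd hl1,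
    altProd_apply_basisVec hTs hTt hstar2 hstarS (simple_mul_mem hd hed)
      (by rw [hl2, hled]; omega),
    apply_basisVec_of_comm_of_lt hTt (mul_mul_inv_star_mem hstar2 hd x) (h1.trans h2.symm)
      (by rw [h1]; omega), h1]

theorem altProd_apply_eq_of_left_unique (hm : orderOf (cs.simple i * cs.simple j) = m) (hm0 : 0 < m)
    (hTs : IsTs cs star i Ts) (hTt : IsTs cs star j Tt) (hstar2 : ∀ w : W, star (star w) = w)
    (hstarS : ∀ i : B, ∃ j : B, star (cs.simple i) = cs.simple j) {d : W} (hd : d ∈ Istar star)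
    (hnd : NoDescent cs i j d) (hid : cs.simple i * d = d * star (cs.simple i))
    (h : ∀ r, r = i ∨ r = j → cs.simple j * d ≠ d * star (cs.simple r)) :
    altProd Ts Tt m (basisVec star d) = altProd Tt Ts m (basisVec star d) := by
  obtain ⟨n, rfl⟩ := Nat.exists_eq_succ_of_ne_zero hm0.ne'
  have huniq : ∀ y, y = cs.simple i ∨ y = cs.simple j → ∀ r, r = i ∨ r = j →
      y * d = d * star (cs.simple r) → y = cs.simple i := by
    rintro y (rfl | rfl) r hr hy
    · rfl
    · exact absurd hy (h r hr)
  by_cases hn : Even n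
  · exact altProd_apply_eq_of_unique hm hTs hTt hstar2 hstarS hd hnd hTs hid hnd.1 huniq
      (by rw [altProd_succ_right, if_pos hn]) (by rw [altProd_succ_right _ _ n, if_pos hn])
  · exact (altProd_apply_eq_of_unique (orderOf_simple_mul_simple_swap hm) hTt hTs hstar2 hstarS hd
      hnd.symm hTs hid hnd.1 (fun y hy r hr => huniq y hy.symm r hr.symm)
      (by rw [altProd_succ_right, if_neg hn]) (by rw [altProd_succ_right _ _ n, if_neg hn])).symm

theorem altProd_sub_apply_recurrence (hTs : IsTs cs star i Ts) (hTt : IsTs cs star j Tt)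
    (hstar2 : ∀ w : W, star (star w) = w)
    (hstarS : ∀ i : B, ∃ j : B, star (cs.simple i) = cs.simple j) (v : InvolModule star) (k : ℕ) :
    altProd Ts Tt (k + 2) v - altProd Tt Ts (k + 2) v =
      ((u ^ 2 - 1 : R) • (1 : Module.End R (InvolModule star)) - (Ts + Tt))
        (altProd Ts Tt (k + 1) v - altProd Tt Ts (k + 1) v) -
      (u ^ 2 : R) • (altProd Ts Tt k v - altProd Tt Ts k v) := by
  have h := add_mul_altProd_sub (E := Module.End R (InvolModule star))
    (mul_self_eq hTs hstar2 hstarS) (mul_self_eq hTt hstar2 hstarS) k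
  rw [← LinearMap.sub_apply, ← LinearMap.sub_apply, ← LinearMap.sub_apply, h,
    LinearMap.sub_apply, Module.End.mul_apply, LinearMap.smul_apply]

theorem altProd_conj_of_swap {d : W} (hid : cs.simple i * d = d * star (cs.simple j))
    (hjd : cs.simple j * d = d * star (cs.simple i)) (p : ℕ) :
    altProd (cs.simple i) (cs.simple j) p * d *
      (star (altProd (cs.simple i) (cs.simple j) p))⁻¹ =
      altProd (cs.simple i) (cs.simple j) (2 * p) * d := by
  have h1 : SemiconjBy d (star (altProd (cs.simple i) (cs.simple j) p))
      (altProd (cs.simple j) (cs.simple i) p) := by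
    rw [map_altProd]
    exact SemiconjBy.altProd hjd.symm hid.symm p
  rw [← altProd_mul_inv_swap (cs.simple_mul_simple_self i) (cs.simple_mul_simple_self j),
    mul_assoc, mul_assoc, (SemiconjBy.inv_right h1).eq]

theorem altProd_conj_of_comm {d : W} (hid : cs.simple i * d = d * star (cs.simple i))
    (hjd : cs.simple j * d = d * star (cs.simple j)) (p : ℕ) :
    altProd (cs.simple i) (cs.simple j) p * ((if Even p then cs.simple i else cs.simple j) * d) *
      (star (altProd (cs.simple i) (cs.simple j) p))⁻¹ =
      altProd (cs.simple i) (cs.simple j) (2 * p + 1) * d := by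
  have h1 : SemiconjBy d (star (altProd (cs.simple i) (cs.simple j) p))
      (altProd (cs.simple i) (cs.simple j) p) := by
    rw [map_altProd]
    exact SemiconjBy.altProd hid.symm hjd.symm p
  rw [← altProd_succ_mul_inv (cs.simple_mul_simple_self i) (cs.simple_mul_simple_self j),
    altProd_succ_right, ← mul_assoc, mul_assoc _ d, mul_assoc _ _ d,
    (SemiconjBy.inv_right h1).eq]

theorem altProd_apply_of_swap (hm : orderOf (cs.simple i * cs.simple j) = m) (hm0 : 0 < m)
    (hTs : IsTs cs star i Ts) (hTt : IsTs cs star j Tt) (hstar2 : ∀ w : W, star (star w) = w)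
    (hstarS : ∀ i : B, ∃ j : B, star (cs.simple i) = cs.simple j) {d : W} (hd : d ∈ Istar star)
    (hnd : NoDescent cs i j d) (hid : cs.simple i * d = d * star (cs.simple j))
    (hjd : cs.simple j * d = d * star (cs.simple i)) {p : ℕ} (hp : 2 * p ≤ m) :
    altProd Ts Tt p (basisVec star d) =
      basisVec star (altProd (cs.simple i) (cs.simple j) (2 * p) * d) := by
  rw [← altProd_conj_of_swap hid hjd]
  refine altProd_apply_basisVec hTs hTt hstar2 hstarS hd ?_
  rw [altProd_conj_of_swap hid hjd, length_altProd_mul hm hm0 hnd.1 hnd.2 hp]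

theorem altProd_apply_succ_of_comm (hm : orderOf (cs.simple i * cs.simple j) = m) (hm0 : 0 < m)
    (hTs : IsTs cs star i Ts) (hTt : IsTs cs star j Tt) (hstar2 : ∀ w : W, star (star w) = w)
    (hstarS : ∀ i : B, ∃ j : B, star (cs.simple i) = cs.simple j) {d : W} (hd : d ∈ Istar star)
    (hnd : NoDescent cs i j d) (hid : cs.simple i * d = d * star (cs.simple i))
    (hjd : cs.simple j * d = d * star (cs.simple j)) {p : ℕ} (hp : 2 * p + 1 ≤ m) :
    altProd Ts Tt (p + 1) (basisVec star d) = u • altProd Ts Tt p (basisVec star d) +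
      (u + 1) • basisVec star (altProd (cs.simple i) (cs.simple j) (2 * p + 1) * d) := by
  have hconj := altProd_conj_of_comm hid hjd p
  have hlen := length_altProd_mul hm hm0 hnd.1 hnd.2 hp
  have hli := cs.length_simple_mul d i
  have hlj := cs.length_simple_mul d j
  obtain ⟨hni, hnj⟩ := hnd
  rw [altProd_succ_right, Module.End.mul_apply]
  split_ifs at hconj ⊢
  · rw [apply_basisVec_of_comm_of_lt hTs hd hid hni, map_add, map_smul, map_smul,
      altProd_apply_basisVec hTs hTt hstar2 hstarS (simple_mul_mem hd hid) (by rw [hconj]; omega),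
      hconj]
  · rw [apply_basisVec_of_comm_of_lt hTt hd hjd hnj, map_add, map_smul, map_smul,
      altProd_apply_basisVec hTs hTt hstar2 hstarS (simple_mul_mem hd hjd) (by rw [hconj]; omega),
      hconj]

theorem apply_basisVec_altProd_mul (hm : orderOf (cs.simple i * cs.simple j) = m)
    (hTt : IsTs cs star j Tt) {n : ℕ} (hn : n + 1 = m) {d : W} (hnd : NoDescent cs i j d)
    (hmem : altProd (cs.simple i) (cs.simple j) n * d ∈ Istar star)
    (hd : altProd (cs.simple i) (cs.simple j) n * d * star (cs.simple j) =
      altProd (cs.simple i) (cs.simple j) m * d) :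
    Tt (basisVec star (altProd (cs.simple i) (cs.simple j) n * d)) =
      u • basisVec star (altProd (cs.simple i) (cs.simple j) n * d) +
        (u + 1) • basisVec star (altProd (cs.simple i) (cs.simple j) m * d) := by
  have h1 : cs.simple j * (altProd (cs.simple i) (cs.simple j) n * d) =
      altProd (cs.simple i) (cs.simple j) m * d := by
    rw [altProd_simple_eq_swap hm, ← hn, altProd_succ, mul_assoc]
  have hm0 : 0 < m := by omega
  have hl := length_altProd_mul hm hm0 hnd.1 hnd.2 (show n ≤ m by omega)
  have hl' := length_altProd_mul hm hm0 hnd.1 hnd.2 (le_refl m)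
  rw [apply_basisVec_of_comm_of_lt hTt hmem (h1.trans hd.symm) (by rw [h1]; omega), h1]

theorem altProd_apply_eq_of_swap (hm : orderOf (cs.simple i * cs.simple j) = m) (hm2 : 2 ≤ m)
    (hTs : IsTs cs star i Ts) (hTt : IsTs cs star j Tt) (hstar2 : ∀ w : W, star (star w) = w)
    (hstarS : ∀ i : B, ∃ j : B, star (cs.simple i) = cs.simple j) {d : W} (hd : d ∈ Istar star)
    (hnd : NoDescent cs i j d) (hid : cs.simple i * d = d * star (cs.simple j))
    (hjd : cs.simple j * d = d * star (cs.simple i)) :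
    altProd Ts Tt m (basisVec star d) = altProd Tt Ts m (basisVec star d) := by
  have hm0 : 0 < m := by omega
  have hm' := orderOf_simple_mul_simple_swap hm
  set f : ℕ → InvolModule star := fun k =>
    altProd Ts Tt k (basisVec star d) - altProd Tt Ts k (basisVec star d) with hfdef
  have hf := altProd_sub_apply_recurrence hTs hTt hstar2 hstarS (basisVec star d)
  have hf0 : f 0 = 0 := sub_self _
  refine sub_eq_zero.1 (show f m = 0 from ?_)
  obtain ⟨p, rfl | rfl⟩ := Nat.even_or_odd' m
  · obtain ⟨b, rfl⟩ := Nat.exists_eq_succ_of_ne_zero (show p ≠ 0 by omega)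
    have h1 : f (b + 1) = 0 := by
      refine sub_eq_zero.2 ?_
      rw [altProd_apply_of_swap hm hm0 hTs hTt hstar2 hstarS hd hnd hid hjd le_rfl,
        altProd_apply_of_swap hm' hm0 hTt hTs hstar2 hstarS hd hnd.symm hjd hid le_rfl,
        altProd_simple_eq_swap hm]
    have h2 : f (b + 1 + 1) = ((-1 : R) * u ^ 2) • f b := by
      have h3 : f (b + 2) = _ - (u ^ 2 : R) • f b := hf b
      rw [h3, show altProd Ts Tt (b + 1) (basisVec star d) -
        altProd Tt Ts (b + 1) (basisVec star d) = 0 from h1, map_zero]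
      module
    have h3 := eq_zero_of_recurrence (f := f) hf hf0 (by rw [h1, smul_zero]) h2
    rwa [show b + 1 + b + 1 = 2 * b.succ by omega] at h3
  · refine eq_zero_of_recurrence_of_sq_eq (f := f) hf hf0 (show p ≠ 0 by omega) (c := -u) (by ring)
      ?_
    have hstep : ∀ {i j : B} {Ts Tt : Module.End R (InvolModule star)},
        orderOf (cs.simple i * cs.simple j) = 2 * p + 1 → IsTs cs star i Ts → IsTs cs star j Tt →
        NoDescent cs i j d → cs.simple i * d = d * star (cs.simple j) →
        cs.simple j * d = d * star (cs.simple i) →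
        altProd Tt Ts (p + 1) (basisVec star d) = u • altProd Ts Tt p (basisVec star d) +
          (u + 1) • basisVec star (altProd (cs.simple i) (cs.simple j) (2 * p + 1) * d) := by
      intro i j Ts Tt hm hTs hTt hnd hid hjd
      rw [altProd_succ, Module.End.mul_apply, altProd_apply_of_swap hm hm0 hTs hTt hstar2 hstarS hd
        hnd hid hjd (by omega)]
      refine apply_basisVec_altProd_mul hm hTt rfl hnd ?_ ?_
      · rw [← altProd_conj_of_swap hid hjd]
        exact mul_mul_inv_star_mem hstar2 hd _
      · rw [mul_assoc, ← hid, ← mul_assoc, altProd_succ_right _ _ (2 * p), if_pos (by simp)]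
    simp only [hfdef]
    rw [hstep hm hTs hTt hnd hid hjd, hstep hm' hTt hTs hnd.symm hjd hid, altProd_simple_eq_swap hm]
    module

theorem altProd_apply_eq_of_comm (hm : orderOf (cs.simple i * cs.simple j) = m) (hm2 : 2 ≤ m)
    (hTs : IsTs cs star i Ts) (hTt : IsTs cs star j Tt) (hstar2 : ∀ w : W, star (star w) = w)
    (hstarS : ∀ i : B, ∃ j : B, star (cs.simple i) = cs.simple j) {d : W} (hd : d ∈ Istar star)
    (hnd : NoDescent cs i j d) (hid : cs.simple i * d = d * star (cs.simple i))
    (hjd : cs.simple j * d = d * star (cs.simple j)) :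
    altProd Ts Tt m (basisVec star d) = altProd Tt Ts m (basisVec star d) := by
  have hm0 : 0 < m := by omega
  have hm' := orderOf_simple_mul_simple_swap hm
  set f : ℕ → InvolModule star := fun k =>
    altProd Ts Tt k (basisVec star d) - altProd Tt Ts k (basisVec star d) with hfdef
  have hf := altProd_sub_apply_recurrence hTs hTt hstar2 hstarS (basisVec star d)
  have hf0 : f 0 = 0 := sub_self _
  refine sub_eq_zero.1 (show f m = 0 from ?_)
  obtain ⟨p, rfl | rfl⟩ := Nat.even_or_odd' m
  · obtain ⟨p, rfl⟩ := Nat.exists_eq_succ_of_ne_zero (show p ≠ 0 by omega)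
    have hstep : ∀ {i j : B} {Ts Tt : Module.End R (InvolModule star)},
        orderOf (cs.simple i * cs.simple j) = 2 * (p + 1) → IsTs cs star i Ts →
        IsTs cs star j Tt → NoDescent cs i j d → cs.simple i * d = d * star (cs.simple i) →
        cs.simple j * d = d * star (cs.simple j) →
        altProd Tt Ts (p + 2) (basisVec star d) = u • altProd Tt Ts (p + 1) (basisVec star d) +
          u • (altProd Ts Tt (p + 1) (basisVec star d) - u • altProd Ts Tt p (basisVec star d)) +
          ((u + 1) * (u + 1)) • basisVec star
            (altProd (cs.simple i) (cs.simple j) (2 * (p + 1)) * d) := by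
      intro i j Ts Tt hm hTs hTt hnd hid hjd
      have h1 := altProd_apply_succ_of_comm hm hm0 hTs hTt hstar2 hstarS hd hnd hid hjd
        (p := p) (by omega)
      have h2 := apply_basisVec_altProd_mul (n := 2 * p + 1) hm hTt rfl hnd
        (by
          rw [← altProd_conj_of_comm hid hjd]
          refine mul_mul_inv_star_mem hstar2 ?_ _
          split_ifs
          · exact simple_mul_mem hd hid
          · exact simple_mul_mem hd hjd)
        (by
          rw [mul_assoc, ← hjd, ← mul_assoc, show 2 * (p + 1) = 2 * p + 1 + 1 by ring,
            altProd_succ_right _ _ (2 * p + 1), if_neg (by simp)])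
      rw [altProd_succ, Module.End.mul_apply, h1, map_add, map_smul, map_smul, h2,
        altProd_succ Tt Ts p, Module.End.mul_apply]
      module
    have h2 : f (p + 1 + 1) = ((1 : R) * u ^ 2) • f p := by
      simp only [hfdef]
      rw [hstep hm hTs hTt hnd hid hjd, hstep hm' hTt hTs hnd.symm hjd hid,
        altProd_simple_eq_swap hm]
      module
    have h3 := eq_zero_of_recurrence (f := f) hf hf0 (one_smul R _).symm h2
    rwa [show p + 1 + p + 1 = 2 * p.succ by omega] at h3
  · refine eq_zero_of_recurrence_of_sq_eq (f := f) hf hf0 (show p ≠ 0 by omega) (c := u) rfl ?_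
    simp only [hfdef]
    rw [altProd_apply_succ_of_comm hm hm0 hTs hTt hstar2 hstarS hd hnd hid hjd le_rfl,
      altProd_apply_succ_of_comm hm' hm0 hTt hTs hstar2 hstarS hd hnd.symm hjd hid le_rfl,
      altProd_simple_eq_swap hm]
    module

theorem eq_star_simple_mul_swap {d : W} (hstar2 : ∀ w : W, star (star w) = w)
    (hd : d ∈ Istar star) (h : cs.simple i * d = d * star (cs.simple j)) :
    cs.simple j * d = d * star (cs.simple i) := by
  have hd' : star d = d⁻¹ := hd
  have h1 := congrArg star h
  rw [map_mul, map_mul, hstar2, hd', mul_inv_eq_iff_eq_mul, mul_assoc] at h1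
  rw [h1, mul_inv_cancel_left]

theorem altProd_apply_eq_of_noDescent (hm : orderOf (cs.simple i * cs.simple j) = m) (hm2 : 2 ≤ m)
    (hTs : IsTs cs star i Ts) (hTt : IsTs cs star j Tt) (hstar2 : ∀ w : W, star (star w) = w)
    (hstarS : ∀ i : B, ∃ j : B, star (cs.simple i) = cs.simple j) {d : W} (hd : d ∈ Istar star)
    (hnd : NoDescent cs i j d) :
    altProd Ts Tt m (basisVec star d) = altProd Tt Ts m (basisVec star d) := by
  have hm0 : 0 < m := by omega
  have hm' := orderOf_simple_mul_simple_swap hm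
  by_cases hswap : cs.simple i * d = d * star (cs.simple j)
  · exact altProd_apply_eq_of_swap hm hm2 hTs hTt hstar2 hstarS hd hnd hswap
      (eq_star_simple_mul_swap hstar2 hd hswap)
  have hswap' : cs.simple j * d ≠ d * star (cs.simple i) :=
    fun h => hswap (eq_star_simple_mul_swap hstar2 hd h)
  by_cases hid : cs.simple i * d = d * star (cs.simple i) <;>
    by_cases hjd : cs.simple j * d = d * star (cs.simple j)
  · exact altProd_apply_eq_of_comm hm hm2 hTs hTt hstar2 hstarS hd hnd hid hjd
  · refine altProd_apply_eq_of_left_unique hm hm0 hTs hTt hstar2 hstarS hd hnd hid ?_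
    rintro r (rfl | rfl)
    exacts [hswap', hjd]
  · refine (altProd_apply_eq_of_left_unique hm' hm0 hTt hTs hstar2 hstarS hd hnd.symm hjd ?_).symm
    rintro r (rfl | rfl)
    exacts [hswap, hid]
  · refine altProd_apply_eq_of_free hm hm0 hTs hTt hstar2 hstarS hd hnd ?_
    rintro y (rfl | rfl) r (rfl | rfl)
    exacts [hid, hswap, hswap', hjd]

theorem u_add_one_ne_zero : u + 1 ≠ 0 := by
  have h : u + 1 = Polynomial.toLaurent (Polynomial.X + Polynomial.C 1) := by simp [u]
  rw [h]
  exact Polynomial.toLaurent_ne_zero.2 (Polynomial.X_add_C_ne_zero 1)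

theorem apply_eq_zero_of_descent (hTs : IsTs cs star i Ts) (hstar2 : ∀ w : W, star (star w) = w)
    (hstarS : ∀ i : B, ∃ j : B, star (cs.simple i) = cs.simple j) {w : W} (hw : w ∈ Istar star)
    (hl : cs.length (cs.simple i * w) < cs.length w)
    {N : Type*} [AddCommGroup N] [Module R N] [Module.IsTorsionFree R N]
    (D : InvolModule star →ₗ[R] N) (hD : ∀ x, D x = 0 → D (Ts x) = 0)
    (h : ∀ w' ∈ Istar star, cs.length w' < cs.length w → D (basisVec star w') = 0) :
    D (basisVec star w) = 0 := by
  by_cases hc : cs.simple i * w = w * star (cs.simple i)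
  · have hss : cs.simple i * (cs.simple i * w) = w := by simp
    have hc' : cs.simple i * (cs.simple i * w) = cs.simple i * w * star (cs.simple i) := by
      rw [hc, ← mul_assoc, hc]
    have hw' := simple_mul_mem hw hc
    have h1 := apply_basisVec_of_comm_of_lt hTs hw' hc' (by rwa [hss])
    have h2 := h _ hw' hl
    have h3 := hD _ h2
    rw [h1, map_add, map_smul, map_smul, h2, smul_zero, zero_add, hss] at h3
    exact (smul_eq_zero.1 h3).resolve_left u_add_one_ne_zero
  · have hw' := conj_star_simple_mem (cs := cs) (i := i) hstar2 hw
    have hconj : cs.simple i * (cs.simple i * w * star (cs.simple i)) * star (cs.simple i) = w := by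
      rw [mul_assoc (cs.simple i) w, ← mul_assoc (cs.simple i), simple_mul_simple_self, one_mul,
        mul_assoc, star_simple_mul_self, mul_one]
    have hl' := length_simple_conj_of_gt hstar2 hstarS hw hl hc
    have h1 := apply_basisVec_of_length_conj hTs hstar2 hstarS hw' (by rw [hconj, hl'])
    rw [hconj] at h1
    rw [← h1]
    exact hD _ (h _ hw' (by omega))

theorem altProd_eq_altProd_swap (hm : orderOf (cs.simple i * cs.simple j) = m) (hm2 : 2 ≤ m)
    (hTs : IsTs cs star i Ts) (hTt : IsTs cs star j Tt) (hstar2 : ∀ w : W, star (star w) = w)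
    (hstarS : ∀ i : B, ∃ j : B, star (cs.simple i) = cs.simple j) :
    altProd Ts Tt m = altProd Tt Ts m := by
  have hQs := mul_self_eq hTs hstar2 hstarS
  have hQt := mul_self_eq hTt hstar2 hstarS
  obtain ⟨k, rfl⟩ := Nat.exists_eq_succ_of_ne_zero (show m ≠ 0 by omega)
  have key : ∀ n, ∀ w ∈ Istar star, cs.length w = n →
      (altProd Ts Tt (k + 1) - altProd Tt Ts (k + 1)) (basisVec star w) = 0 := by
    intro n
    induction n using Nat.strong_induction_on with
    | _ n ih =>
      rintro w hw rfl
      by_cases hi : cs.length (cs.simple i * w) < cs.length w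
      · refine apply_eq_zero_of_descent hTs hstar2 hstarS hw hi _ (fun x hx => ?_)
          fun w' hw' hl => ih _ hl w' hw' rfl
        rw [LinearMap.sub_apply, sub_eq_zero] at hx ⊢
        exact altProd_sub_apply_eq_zero hQs hQt hx
      by_cases hj : cs.length (cs.simple j * w) < cs.length w
      · refine apply_eq_zero_of_descent hTt hstar2 hstarS hw hj _ (fun x hx => ?_)
          fun w' hw' hl => ih _ hl w' hw' rfl
        rw [LinearMap.sub_apply, sub_eq_zero] at hx ⊢
        exact (altProd_sub_apply_eq_zero hQt hQs hx.symm).symm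
      rw [LinearMap.sub_apply, sub_eq_zero]
      exact altProd_apply_eq_of_noDescent hm hm2 hTs hTt hstar2 hstarS hw
        ⟨lt_of_le_of_ne (not_lt.1 hi) (cs.length_simple_mul_ne w i).symm,
          lt_of_le_of_ne (not_lt.1 hj) (cs.length_simple_mul_ne w j).symm⟩
  exact end_ext fun w hw => sub_eq_zero.1 (key _ w hw rfl)

end Operators

end TwistedInvolutions

end CoxeterSystem

/-- for distinct simple reflections `s, t ∈ S` such that `s * t` has finite
order `m` in `W`, the alternating composite `T_s ∘ T_t ∘ T_s ∘ ⋯` with `m` factors equals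
the alternating composite `T_t ∘ T_s ∘ T_t ∘ ⋯` with `m` factors. -/
theorem Ts_braid_relation {B W : Type*} [Group W] {Mat : CoxeterMatrix B}
    (cs : CoxeterSystem Mat W) (star : W ≃* W)
    (hstar2 : ∀ w : W, star (star w) = w)
    (hstarS : ∀ i : B, ∃ j : B, star (cs.simple i) = cs.simple j)
    (i j : B) (hij : cs.simple i ≠ cs.simple j)
    (m : ℕ) (hfin : IsOfFinOrder (cs.simple i * cs.simple j))
    (hm : orderOf (cs.simple i * cs.simple j) = m)
    (Ts Tt : InvolModule star →ₗ[R] InvolModule star)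
    (hTs : IsTs cs star i Ts) (hTt : IsTs cs star j Tt) :
    altComp (Ts : Module.End R (InvolModule star)) Tt m = altComp (Tt : Module.End R (InvolModule star)) Ts m := by
  rw [altComp_eq_altProd, altComp_eq_altProd]
  have hm0 : m ≠ 0 := by
    rw [← hm]
    exact hfin.orderOf_pos.ne'
  have hm1 : m ≠ 1 := by
    rintro rfl
    rw [orderOf_eq_one_iff, mul_eq_one_iff_eq_inv, cs.inv_simple] at hm
    exact hij hm
  exact CoxeterSystem.altProd_eq_altProd_swap hm (by omega) hTs hTt hstar2 hstarS

end
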